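/- arXiv:2011.04563 — 2 statements merged into one kernel-verified Lean document; each statement's English description precedes it below -/
import Mathlib

section
/- For every integer n ≥ 1, the finite sequence (p_1^(n), p_2^(n), …, p_n^(n)) is a Pólya frequency sequence: setting a_j := p_{j+1}^(n) for 0 ≤ j ≤ n−1 and a_j := 0 for all other integers j, every square minor of the infinite Toeplitz matrix (a_{i−j})_{i,j ≥ 0} has nonnegative determinant; that is, for every m ≥ 1 and all strictly increasing tuples of indices i_1 < ⋯ < i_m and j_1 < ⋯ < j_m of nonnegative integers, det((a_{i_s − j_t})_{1 ≤ s,t ≤ m}) ≥ 0. -/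
open Finset

/-- `p n k` is the probability `p_k^{(n)} = P(f_0(T_n) = k)` that the random convex chain
`T_n` has exactly `k` vertices (besides the two corners), given by Buchta's formula:
`p_k^{(n)} = 2^k · Σ_{i_1+⋯+i_k = n, i_j ≥ 1} Π_{j=1}^{k} i_j / (s_j (s_j + 1))`,
where `s_j = i_1 + ⋯ + i_j`.  In particular `p 0 0 = 1` and `p n 0 = 0` for `n ≥ 1`,
and `p n k = 0` for `k > n`. -/
noncomputable def p (n k : ℕ) : ℝ :=
  2 ^ k *
    ∑ i ∈ (Fintype.piFinset fun _ : Fin k => Finset.Icc 1 n).filter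
        (fun i => ∑ j, i j = n),
      ∏ j : Fin k,
        (i j : ℝ) /
          (((∑ l ∈ Finset.univ.filter (fun l => l ≤ j), i l : ℕ) : ℝ) *
            (((∑ l ∈ Finset.univ.filter (fun l => l ≤ j), i l : ℕ) : ℝ) + 1))

/-- Restriction to the initial segment turns the compositions of `n` into `k + 1` parts into the
pairs of a last part `c` and a composition of `n - c` into `k` parts. -/
theorem p_succ (n k : ℕ) :
    (n : ℝ) * (n + 1) * p n (k + 1) = 2 * ∑ c ∈ Finset.Icc 1 n, (c : ℝ) * p (n - c) k := by
  rcases Nat.eq_zero_or_pos n with rfl | hn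
  · simp
  have hn0 : (n : ℝ) * (n + 1) ≠ 0 := by positivity
  unfold p
  simp_rw [Finset.mul_sum]
  rw [Finset.sum_sigma']
  refine Finset.sum_nbij' (fun i => ⟨i (Fin.last k), Fin.init i⟩)
    (fun x => Fin.snoc (α := fun _ => ℕ) x.2 x.1) ?_ ?_ ?_ ?_ ?_
  · intro i hi
    simp only [Finset.mem_filter, Fintype.mem_piFinset, Finset.mem_Icc, Finset.mem_sigma] at hi ⊢
    obtain ⟨h1, h2⟩ := hi
    rw [Fin.sum_univ_castSucc] at h2
    refine ⟨h1 _, fun j => ⟨(h1 _).1, ?_⟩, ?_⟩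
    · have := Finset.single_le_sum (f := fun j : Fin k => i j.castSucc) (fun _ _ => Nat.zero_le _)
        (Finset.mem_univ j)
      simp only [Fin.init] at this ⊢
      omega
    · simp only [Fin.init]
      omega
  · rintro ⟨c, f⟩ hx
    simp only [Finset.mem_filter, Fintype.mem_piFinset, Finset.mem_Icc, Finset.mem_sigma] at hx ⊢
    obtain ⟨hc, h1, h2⟩ := hx
    refine ⟨fun j => ?_, ?_⟩
    · refine Fin.lastCases ?_ (fun j => ?_) j
      · simpa using hc
      · have := h1 j
        simp only [Fin.snoc_castSucc]
        omega
    · rw [Fin.sum_univ_castSucc]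
      simp only [Fin.snoc_castSucc, Fin.snoc_last]
      omega
  · intro i _
    exact Fin.snoc_init_self i
  · rintro ⟨c, f⟩ _
    simp
  · intro i hi
    simp only [Finset.mem_filter, Fintype.mem_piFinset, Finset.mem_Icc] at hi
    have hlast : ∑ l ∈ Finset.univ.filter (fun l => l ≤ Fin.last k), i l = n := by
      simpa [Fin.le_last] using hi.2
    have hcast (j : Fin k) : ∑ l ∈ Finset.univ.filter (fun l => l ≤ j.castSucc), i l =
        ∑ l ∈ Finset.univ.filter (fun l => l ≤ j), Fin.init i l := by
      rw [Finset.sum_filter, Finset.sum_filter, Fin.sum_univ_castSucc]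
      simp [Fin.init]
    rw [Fin.prod_univ_castSucc, hlast]
    simp_rw [hcast]
    simp only [Fin.init]
    field_simp
    ring

theorem p_nonneg (n k : ℕ) : 0 ≤ p n k := by
  unfold p
  positivity

theorem p_eq_zero_of_lt {n k : ℕ} (h : n < k) : p n k = 0 := by
  unfold p
  rw [Finset.filter_eq_empty_iff.2, Finset.sum_empty, mul_zero]
  intro i hi hsum
  have : ∑ _j : Fin k, 1 ≤ ∑ j, i j :=
    Finset.sum_le_sum fun j _ => (Finset.mem_Icc.1 (Fintype.mem_piFinset.1 hi j)).1
  simp at this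
  omega

theorem p_zero_zero : p 0 0 = 1 := by simp [p]

theorem p_succ_zero (n : ℕ) : p (n + 1) 0 = 0 := by simp [p]

theorem p_add_two_succ (n k : ℕ) :
    ((n : ℝ) + 2) * (n + 3) * p (n + 2) (k + 1) =
      2 * (n + 1) * (n + 2) * p (n + 1) (k + 1) + 2 * p (n + 1) k - n * (n + 1) * p n (k + 1) := by
  have key (N : ℕ) : (N : ℝ) * (N + 1) * p N (k + 1) =
      2 * ∑ m ∈ Finset.range N, ((N : ℝ) - m) * p m k := by
    rw [p_succ, ← Finset.sum_range_reflect]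
    congr 1
    refine Finset.sum_nbij' (fun c => c - 1) (fun c => c + 1) ?_ ?_ ?_ ?_ ?_
    · intro c hc
      simp only [Finset.mem_Icc, Finset.mem_range] at hc ⊢
      omega
    · intro c hc
      simp only [Finset.mem_Icc, Finset.mem_range] at hc ⊢
      omega
    · intro c hc
      simp only [Finset.mem_Icc] at hc
      omega
    · intro c _
      omega
    · intro c hc
      simp only [Finset.mem_Icc] at hc
      have h : N - 1 - (c - 1) = N - c := by omega
      rw [h, Nat.cast_sub hc.2]
      ring
  have h0 := key n
  have h1 := key (n + 1)
  have h2 := key (n + 2)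
  simp only [Finset.sum_range_succ, sub_mul, Finset.sum_sub_distrib, ← Finset.mul_sum]
    at h0 h1 h2
  push_cast at h0 h1 h2
  linear_combination h2 - 2 * h1 + h0

open Polynomial

/-- The generating polynomial of the sequence `p n 0, …, p n n`. -/
noncomputable def pPoly (n : ℕ) : ℝ[X] := ∑ k ∈ Finset.range (n + 1), C (p n k) * X ^ k

theorem coeff_pPoly (n k : ℕ) : (pPoly n).coeff k = p n k := by
  simp only [pPoly, finsetSum_coeff, coeff_C_mul_X_pow, Finset.sum_ite_eq, Finset.mem_range]
  split_ifs with h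
  · rfl
  · exact (p_eq_zero_of_lt (by omega)).symm

theorem pPoly_recurrence (n : ℕ) :
    C (((n : ℝ) + 2) * (n + 3)) * pPoly (n + 2) =
      C (2 * ((n : ℝ) + 1) * (n + 2)) * pPoly (n + 1) + C 2 * (X * pPoly (n + 1)) -
        C ((n : ℝ) * (n + 1)) * pPoly n := by
  ext (_ | k)
  · simp only [coeff_sub, coeff_add, coeff_C_mul, coeff_X_mul_zero, coeff_pPoly, p_succ_zero]
    rcases n with _ | n
    · simp
    · simp [p_succ_zero]
  · simp only [coeff_sub, coeff_add, coeff_C_mul, coeff_X_mul, coeff_pPoly]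
    exact p_add_two_succ n k

theorem pPoly_zero : pPoly 0 = 1 := by
  simp [pPoly, p_zero_zero]

theorem pPoly_one : pPoly 1 = X := by
  have h := p_succ 1 0
  simp [p_zero_zero] at h
  have h : p 1 1 = 1 := by linarith
  simp [pPoly, Finset.sum_range_succ, p_succ_zero, h]

open ComplexConjugate in
/-- The Christoffel–Darboux kernel of consecutive generating polynomials is positive off the real
axis. -/
theorem im_mul_im_aeval_pPoly_pos {z : ℂ} (hz : z.im ≠ 0) (n : ℕ) :
    0 < z.im * (aeval z (pPoly (n + 1)) * conj (aeval z (pPoly n))).im := by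
  induction n with
  | zero =>
    simp only [zero_add, pPoly_one, pPoly_zero, aeval_X, map_one, mul_one]
    exact mul_self_pos.2 hz
  | succ n ih =>
    have hrec := congrArg (aeval z) (pPoly_recurrence n)
    simp only [map_sub, map_add, map_mul, aeval_C, aeval_X, Complex.coe_algebraMap] at hrec
    set u := aeval z (pPoly n)
    set v := aeval z (pPoly (n + 1))
    set w := aeval z (pPoly (n + 1 + 1))
    have hv : 0 < v.re ^ 2 + v.im ^ 2 := by
      have hv0 : v ≠ 0 := by
        intro h
        simp [h] at ih
      have := Complex.normSq_pos.2 hv0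
      rw [Complex.normSq_apply] at this
      nlinarith
    have hre := congrArg Complex.re hrec
    have him := congrArg Complex.im hrec
    simp only [Complex.add_re, Complex.sub_re, Complex.mul_re,
      Complex.add_im, Complex.sub_im, Complex.mul_im, Complex.ofReal_re, Complex.ofReal_im,
      zero_mul, sub_zero, add_zero] at hre him
    simp only [Complex.mul_im, Complex.conj_re, Complex.conj_im] at ih ⊢
    have hkey : ((n : ℝ) + 2) * (n + 3) * (z.im * (w.re * -v.im + w.im * v.re)) =
        2 * (z.im ^ 2 * (v.re ^ 2 + v.im ^ 2)) +
          n * (n + 1) * (z.im * (v.re * -u.im + v.im * u.re)) := by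
      linear_combination z.im * v.re * him - z.im * v.im * hre
    have hpos : 0 < ((n : ℝ) + 2) * (n + 3) * (z.im * (w.re * -v.im + w.im * v.re)) := by
      rw [hkey]
      have : 0 < z.im ^ 2 * (v.re ^ 2 + v.im ^ 2) := by positivity
      have : 0 ≤ (n : ℝ) * (n + 1) * (z.im * (v.re * -u.im + v.im * u.re)) := by positivity
      linarith
    exact pos_of_mul_pos_right hpos (by positivity)

theorem aeval_pPoly_ne_zero {z : ℂ} (hz : z.im ≠ 0) (n : ℕ) : aeval z (pPoly (n + 1)) ≠ 0 := by
  intro h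
  simpa [h] using im_mul_im_aeval_pPoly_pos hz n

theorem pPoly_succ_ne_zero (n : ℕ) : pPoly (n + 1) ≠ 0 := by
  intro h
  exact aeval_pPoly_ne_zero (z := Complex.I) (by simp) n (by simp [h])

theorem splits_pPoly_succ (n : ℕ) : (pPoly (n + 1)).Splits := by
  refine Splits.of_splits_map (algebraMap ℝ ℂ) (IsAlgClosed.splits _) fun z hz => ?_
  rw [mem_roots', IsRoot.def, eval_map_algebraMap] at hz
  by_cases him : z.im = 0
  · exact ⟨z.re, Complex.ext (by simp) (by simp [him])⟩
  · exact absurd hz.2 (aeval_pPoly_ne_zero him n)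

theorem roots_nonpos_of_coeff_nonneg {q : ℝ[X]} (hq : ∀ k, 0 ≤ q.coeff k) {r : ℝ}
    (hr : r ∈ q.roots) : r ≤ 0 := by
  rw [mem_roots', IsRoot.def, eval_eq_sum_range] at hr
  by_contra! hpos
  have hterm := (Finset.sum_eq_zero_iff_of_nonneg fun k _ =>
    mul_nonneg (hq k) (pow_nonneg hpos.le k)).1 hr.2 q.natDegree (by simp)
  rcases mul_eq_zero.1 hterm with h | h
  · exact hr.1 (leadingCoeff_eq_zero.1 h)
  · exact (pow_pos hpos _).ne' h

/-- The Toeplitz matrix of the doubly infinite sequence `b` is totally nonnegative. -/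
def ToeplitzTotallyNonneg (b : ℤ → ℝ) : Prop :=
  ∀ (m : ℕ) (i j : Fin m → ℤ), StrictMono i → StrictMono j →
    0 ≤ Matrix.det (Matrix.of fun s t => b (i s - j t))

theorem ToeplitzTotallyNonneg.single {c : ℝ} (hc : 0 ≤ c) :
    ToeplitzTotallyNonneg fun k => if k = 0 then c else 0 := by
  intro m i j hi hj
  by_cases hij : i = j
  · subst hij
    have : (Matrix.of fun s t => if i s - i t = 0 then c else 0) =
        Matrix.diagonal fun _ : Fin m => c := by
      ext s t
      simp [Matrix.diagonal_apply, sub_eq_zero, hi.injective.eq_iff]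
    rw [this, Matrix.det_diagonal]
    positivity
  · rw [Matrix.det_apply, Finset.sum_eq_zero]
    intro σ _
    have : ∃ s, i (σ s) ≠ j s := by
      by_contra! h
      refine hij ((hi.range_inj hj).1 ?_)
      rw [← funext h, Set.range_comp' i σ, σ.surjective.range_eq, Set.image_univ]
    obtain ⟨s, hs⟩ := this
    rw [Finset.prod_eq_zero (Finset.mem_univ s) (by simp [sub_eq_zero, hs]), smul_zero]

theorem ToeplitzTotallyNonneg.shift_add {b : ℤ → ℝ} (hb : ToeplitzTotallyNonneg b) {r : ℝ}
    (hr : 0 ≤ r) : ToeplitzTotallyNonneg fun k => b (k - 1) + r * b k := by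
  classical
  intro m i j hi hj
  have hsplit : (Matrix.of fun s t => b (i s - j t - 1) + r * b (i s - j t)) =
      (fun s t => b (i s - 1 - j t)) + fun (s t : Fin m) => r * b (i s - j t) := by
    ext s t
    simp [sub_right_comm]
  rw [hsplit]
  change 0 ≤ Matrix.detRowAlternating _
  rw [AlternatingMap.map_add_univ]
  refine Finset.sum_nonneg fun S _ => ?_
  have hrow : S.piecewise (fun s t => b (i s - 1 - j t)) (fun (s t : Fin m) => r * b (i s - j t)) =
      Matrix.of fun s t => (if s ∈ S then 1 else r) *
        (Matrix.of fun s t => b ((if s ∈ S then i s - 1 else i s) - j t)) s t := by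
    ext s t
    by_cases hs : s ∈ S <;> simp [hs]
  rw [hrow]
  change 0 ≤ Matrix.det _
  rw [Matrix.det_mul_column]
  refine mul_nonneg (Finset.prod_nonneg fun s _ => by split_ifs <;> positivity) ?_
  by_cases hinj : Function.Injective fun s => if s ∈ S then i s - 1 else i s
  · refine hb m _ j (Monotone.strictMono_of_injective (fun s t hst => ?_) hinj) hj
    rcases hst.eq_or_lt with rfl | hlt
    · rfl
    · have := hi hlt
      split_ifs <;> omega
  · simp only [Function.Injective, not_forall] at hinj
    obtain ⟨s, t, hst, hne⟩ := hinj
    rw [Matrix.det_zero_of_row_eq hne]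
    ext l
    simp [hst]

/-- The coefficients of a polynomial as a doubly infinite sequence. -/
noncomputable def Polynomial.intCoeff (q : ℝ[X]) (k : ℤ) : ℝ :=
  if 0 ≤ k then q.coeff k.toNat else 0

theorem Polynomial.intCoeff_C (c : ℝ) : (C c).intCoeff = fun k => if k = 0 then c else 0 := by
  ext k
  rcases k with (_ | k) | k <;> simp [intCoeff, coeff_C]
  omega

theorem Polynomial.intCoeff_X_sub_C_mul (r : ℝ) (q : ℝ[X]) :
    ((X - C r) * q).intCoeff = fun k => q.intCoeff (k - 1) + -r * q.intCoeff k := by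
  ext k
  rw [sub_mul]
  rcases k with (_ | k) | k
  · simp [intCoeff]
  · have h : (0 : ℤ) ≤ k + 1 := by positivity
    simp [intCoeff, coeff_X_mul, h]
    ring
  · simp [intCoeff]

/-- The coefficients of a polynomial with only nonpositive real roots and nonnegative leading
coefficient form a Pólya frequency sequence. -/
theorem Polynomial.Splits.toeplitzTotallyNonneg {q : ℝ[X]} (hq : q.Splits)
    (hlead : 0 ≤ q.leadingCoeff) (hroots : ∀ r ∈ q.roots, r ≤ 0) :
    ToeplitzTotallyNonneg q.intCoeff := by
  rw [hq.eq_prod_roots]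
  generalize q.roots = R at hroots
  induction R using Multiset.induction_on with
  | empty =>
    simpa [intCoeff_C] using ToeplitzTotallyNonneg.single hlead
  | cons r R ih =>
    rw [Multiset.map_cons, Multiset.prod_cons, mul_left_comm, intCoeff_X_sub_C_mul]
    exact (ih fun s hs => hroots s (Multiset.mem_cons_of_mem hs)).shift_add
      (neg_nonneg.2 (hroots r (Multiset.mem_cons_self r R)))

/-- Theorem 5: for every `n ≥ 1` the finite sequence `(p_1^{(n)}, …, p_n^{(n)})` is a
Pólya frequency sequence: extending it by zeros to a doubly infinite sequence
`a : ℤ → ℝ` with `a j = p_{j+1}^{(n)}` for `0 ≤ j ≤ n − 1` and `a j = 0` otherwise,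
every square minor of the Toeplitz matrix `(a (i − j))_{i,j ≥ 0}` has nonnegative
determinant: for every `m ≥ 1` and all strictly increasing index tuples
`i₁ < ⋯ < i_m`, `j₁ < ⋯ < j_m` of nonnegative integers,
`det ((a (i_s − j_t))_{s,t}) ≥ 0`. -/
theorem p_polya_frequency (n : ℕ) (hn : 1 ≤ n)
    (a : ℤ → ℝ)
    (ha : ∀ j : ℤ, a j = if 0 ≤ j ∧ j ≤ (n : ℤ) - 1 then p n (j.toNat + 1) else 0)
    (m : ℕ) (hm : 1 ≤ m)
    (i j : Fin m → ℕ) (hi : StrictMono i) (hj : StrictMono j) :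
    0 ≤ Matrix.det (Matrix.of fun s t : Fin m => a ((i s : ℤ) - (j t : ℤ))) := by
  obtain ⟨n, rfl⟩ := Nat.exists_eq_succ_of_ne_zero (Nat.one_le_iff_ne_zero.1 hn)
  have hcoeff (k : ℕ) : 0 ≤ (pPoly (n + 1)).coeff k := by
    rw [coeff_pPoly]
    exact p_nonneg _ _
  have htoep := (splits_pPoly_succ n).toeplitzTotallyNonneg (hcoeff _)
    fun r hr => roots_nonpos_of_coeff_nonneg hcoeff hr
  have hshift (k : ℤ) : a k = (pPoly (n + 1)).intCoeff (k + 1) := by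
    rw [ha, intCoeff, coeff_pPoly]
    rcases lt_trichotomy k (-1) with h | rfl | h
    · rw [if_neg (by omega), if_neg (by omega)]
    · simp [p_succ_zero]
    · have hk : (k + 1).toNat = k.toNat + 1 := by omega
      rw [if_pos (show 0 ≤ k + 1 by omega), hk]
      split_ifs with hle
      · rfl
      · exact (p_eq_zero_of_lt (by push_cast at hle; omega)).symm
  have h := htoep m (fun s => (i s : ℤ) + 1) (fun t => (j t : ℤ))
    (fun s t hst => by have := hi hst; dsimp only; omega)
    (fun s t hst => by have := hj hst; dsimp only; omega)
  simpa only [hshift, sub_add_eq_add_sub] using h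
end

section
/- For every integer n ≥ 3 and every integer k with 2 ≤ k ≤ n−1, the probabilities satisfy the strong log-concavity inequality (p_k^(n))² ≥ p_{k−1}^(n)·p_{k+1}^(n)·(1 + 1/(k−1))·(1 + 1/(n−k)). -/
open Finset

/-- The summand of `p n k` attached to the composition `i`. -/
noncomputable def chainWeight {k : ℕ} (i : Fin k → ℕ) : ℝ :=
  ∏ j : Fin k,
    (i j : ℝ) /
      (((∑ l ∈ Finset.univ.filter (fun l => l ≤ j), i l : ℕ) : ℝ) *
        (((∑ l ∈ Finset.univ.filter (fun l => l ≤ j), i l : ℕ) : ℝ) + 1))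

/-- The compositions of `n` into `k` positive parts. -/
def chainCompositions (n k : ℕ) : Finset (Fin k → ℕ) :=
  (Fintype.piFinset fun _ : Fin k => Finset.Icc 1 n).filter (fun i => ∑ j, i j = n)

theorem p_eq_sum_chainWeight (n k : ℕ) :
    p n k = 2 ^ k * ∑ i ∈ chainCompositions n k, chainWeight i := rfl

theorem mem_chainCompositions {n k : ℕ} {i : Fin k → ℕ} :
    i ∈ chainCompositions n k ↔ (∀ j, 1 ≤ i j) ∧ ∑ j, i j = n := by
  simp only [chainCompositions, mem_filter, Fintype.mem_piFinset, mem_Icc]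
  refine ⟨fun h => ⟨fun j => (h.1 j).1, h.2⟩, fun h => ⟨fun j => ⟨h.1 j, ?_⟩, h.2⟩⟩
  rw [← h.2]
  exact single_le_sum (fun _ _ => Nat.zero_le _) (mem_univ j)

theorem chainWeight_snoc {k : ℕ} (i : Fin k → ℕ) (a : ℕ) :
    chainWeight (Fin.snoc i a : Fin (k + 1) → ℕ) =
      chainWeight i * (a / (((∑ j, i j + a : ℕ) : ℝ) * (((∑ j, i j + a : ℕ) : ℝ) + 1))) := by
  unfold chainWeight
  rw [Fin.prod_univ_castSucc]
  simp only [sum_filter, Fin.sum_univ_castSucc, Fin.snoc_castSucc, Fin.snoc_last,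
    Fin.castSucc_le_castSucc_iff, Fin.le_last, if_true]
  congr 1
  refine prod_congr rfl fun j _ => ?_
  rw [if_neg (not_le.mpr (Fin.castSucc_lt_last j)), add_zero]

theorem p_zero_right (n : ℕ) : p n 0 = if n = 0 then 1 else 0 := by
  rcases eq_or_ne n 0 with rfl | h
  · simp [p]
  · simp [p, h, h.symm]

theorem sum_chainWeight_succ (n k : ℕ) :
    ∑ i ∈ chainCompositions n (k + 1), chainWeight i =
      ∑ m ∈ range n, ∑ i ∈ chainCompositions m k,
        chainWeight i * (((n : ℝ) - m) / (n * (n + 1))) := by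
  rw [sum_sigma']
  refine sum_bij' (fun i _ => ⟨∑ j, Fin.init i j, Fin.init i⟩)
    (fun x _ => (Fin.snoc x.2 (n - x.1) : Fin (k + 1) → ℕ)) ?_ ?_ ?_ ?_ ?_
  · intro i hi
    rw [mem_chainCompositions, Fin.sum_univ_castSucc] at hi
    have := hi.1 (Fin.last k)
    simp only [mem_sigma, mem_range, mem_chainCompositions, Fin.init]
    exact ⟨by omega, fun j => hi.1 _, trivial⟩
  · rintro ⟨m, i⟩ hx
    simp only [mem_sigma, mem_range, mem_chainCompositions] at hx
    rw [mem_chainCompositions, Fin.sum_univ_castSucc, Fin.forall_fin_succ']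
    simp only [Fin.snoc_castSucc, Fin.snoc_last]
    exact ⟨⟨hx.2.1, by omega⟩, by omega⟩
  · intro i hi
    rw [mem_chainCompositions, Fin.sum_univ_castSucc] at hi
    have h : n - ∑ j, Fin.init i j = i (Fin.last k) := by
      simp only [Fin.init]
      omega
    simp only [h, Fin.snoc_init_self]
  · rintro ⟨m, i⟩ hx
    simp only [mem_sigma, mem_range, mem_chainCompositions] at hx
    obtain ⟨-, -, rfl⟩ := hx
    simp
  · intro i hi
    rw [mem_chainCompositions, Fin.sum_univ_castSucc] at hi
    have hn : (∑ j, Fin.init i j) + i (Fin.last k) = n := hi.2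
    conv_lhs => rw [← Fin.snoc_init_self i, chainWeight_snoc, hn]
    simp only [← hn, Nat.cast_add, add_sub_cancel_left]

theorem p_succ_right (n k : ℕ) :
    (n : ℝ) * (n + 1) * p n (k + 1) = 2 * ∑ m ∈ range n, ((n : ℝ) - m) * p m k := by
  rcases eq_or_ne n 0 with rfl | hn
  · simp
  simp only [p_eq_sum_chainWeight, sum_chainWeight_succ, ← sum_mul]
  rw [← mul_assoc, mul_sum, mul_sum]
  refine sum_congr rfl fun m _ => ?_
  field_simp
  ring

theorem p_recurrence (n k : ℕ) :
    ((n : ℝ) + 2) * (n + 3) * p (n + 2) (k + 1) =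
      2 * ((n + 1) * (n + 2) * p (n + 1) (k + 1) + p (n + 1) k) - n * (n + 1) * p n (k + 1) := by
  have h₀ := p_succ_right n k
  have h₁ := p_succ_right (n + 1) k
  have h₂ := p_succ_right (n + 2) k
  simp only [sum_range_succ, sub_mul, sum_sub_distrib, ← mul_sum] at h₀ h₁ h₂
  push_cast at h₀ h₁ h₂
  linear_combination h₂ - 2 * h₁ + h₀

open Polynomial in
/-- The generating polynomial `∑ k, p n k * X ^ k`, given by its three-term recurrence. -/
noncomputable def chainPoly : ℕ → ℝ[X]
  | 0 => 1
  | 1 => X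
  | n + 2 => C (((n : ℝ) + 2) * (n + 3))⁻¹ *
      (2 * (C (((n : ℝ) + 1) * (n + 2)) * chainPoly (n + 1) + X * chainPoly (n + 1)) -
        C ((n : ℝ) * (n + 1)) * chainPoly n)

open Polynomial in
theorem coeff_chainPoly (n k : ℕ) : (chainPoly n).coeff k = p n k := by
  induction n using Nat.twoStepInduction generalizing k with
  | zero =>
    rcases k with _ | k
    · simp [chainPoly, p_zero_right]
    · simp [chainPoly, p_eq_zero_of_lt, coeff_one]
  | one =>
    rcases k with _ | k
    · simp [chainPoly, p_zero_right]
    · have h := p_succ_right 1 k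
      simp only [sum_range_one, coeff_X, chainPoly] at h ⊢
      rcases k with _ | k
      · rw [p_zero_right] at h
        norm_num at h ⊢
        linarith
      · rw [p_eq_zero_of_lt (by omega)]
        simp
  | more n h₀ h₁ =>
    have hn : ((n : ℝ) + 2) * (n + 3) ≠ 0 := by positivity
    rcases k with _ | k
    · rw [chainPoly, coeff_C_mul, coeff_sub, coeff_C_mul, h₀]
      rcases n with _ | n <;> simp [mul_coeff_zero, h₁, p_zero_right]
    · rw [chainPoly, coeff_C_mul, coeff_sub, coeff_C_mul, h₀, ← C_ofNat, coeff_C_mul,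
        coeff_add, coeff_C_mul, coeff_X_mul, h₁, h₁, ← p_recurrence]
      field_simp

open Polynomial in
theorem natDegree_chainPoly_le (n : ℕ) : (chainPoly n).natDegree ≤ n :=
  natDegree_le_iff_coeff_eq_zero.mpr fun _ h => by
    rw [coeff_chainPoly, p_eq_zero_of_lt h]

open Polynomial in
/-- Consecutive chain polynomials satisfy a Herglotz-type positivity off the real axis. -/
theorem chainPoly_im_pos (z : ℂ) (hz : z.im ≠ 0) (n : ℕ) :
    0 < z.im * (aeval z (chainPoly (n + 1)) *
      (starRingEnd ℂ) (aeval z (chainPoly n))).im := by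
  induction n with
  | zero => simpa [chainPoly] using mul_self_pos.mpr hz
  | succ n ih =>
    set u := aeval z (chainPoly n)
    set v := aeval z (chainPoly (n + 1))
    have hv₀ : v ≠ 0 := fun h => by simp [h] at ih
    have hn : 0 < (((n : ℝ) + 2) * (n + 3))⁻¹ := by positivity
    have hrec : aeval z (chainPoly (n + 2)) = ((((n : ℝ) + 2) * (n + 3))⁻¹ : ℝ) *
        (2 * ((((n : ℝ) + 1) * (n + 2) : ℝ) * v + z * v) - (((n : ℝ) * (n + 1) : ℝ)) * u) := by
      rw [chainPoly]
      have h2 : aeval z (2 : ℝ[X]) = 2 := map_ofNat _ 2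
      simp [u, v, h2]
    have him : z.im * (aeval z (chainPoly (n + 2)) * (starRingEnd ℂ) v).im =
        (((n : ℝ) + 2) * (n + 3))⁻¹ * (2 * (z.im ^ 2 * Complex.normSq v) +
          (n : ℝ) * (n + 1) * (z.im * (v * (starRingEnd ℂ) u).im)) := by
      rw [hrec]
      generalize (((n : ℝ) + 2) * (n + 3))⁻¹ = a, ((n : ℝ) + 1) * (n + 2) = b,
        (n : ℝ) * (n + 1) = c
      simp [Complex.normSq_apply]
      ring
    rw [him]
    have := Complex.normSq_pos.mpr hv₀
    positivity

open Polynomial in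
theorem splits_of_forall_aeval_ne_zero {f : ℝ[X]} (h : ∀ z : ℂ, z.im ≠ 0 → aeval z f ≠ 0) :
    f.Splits := by
  refine (IsAlgClosed.splits (f.map (algebraMap ℝ ℂ))).of_splits_map _ fun z hz => ?_
  refine ⟨z.re, Complex.ext rfl ?_⟩
  by_contra hne
  refine h z (fun h => hne (by simp [h])) ?_
  rw [aeval_def, ← eval_map]
  exact (mem_roots'.mp hz).2

open Polynomial in
theorem splits_chainPoly (n : ℕ) : (chainPoly n).Splits := by
  refine splits_of_forall_aeval_ne_zero fun z hz h => ?_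
  simpa [h] using chainPoly_im_pos z hz n

open Polynomial in
theorem splits_derivative {f : ℝ[X]} (hf : f.Splits) : f.derivative.Splits := by
  rcases eq_or_ne f.natDegree 0 with h | h
  · exact Splits.of_natDegree_eq_zero (by have := natDegree_derivative_le f; omega)
  rw [splits_iff_card_roots] at hf ⊢
  have h₁ := card_roots_le_derivative f
  have h₂ := card_roots' f.derivative
  have h₃ := natDegree_derivative_lt h
  omega

open Polynomial in
/-- The first of Newton's inequalities for a product of monic linear factors. -/
theorem newton_prod_X_sub_C (s : Multiset ℝ) :
    2 * (s.card : ℝ) * ((s.map (X - C ·)).prod.coeff 0 * (s.map (X - C ·)).prod.coeff 2) ≤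
      ((s.card : ℝ) - 1) * (s.map (X - C ·)).prod.coeff 1 ^ 2 := by
  induction s using Multiset.induction with
  | empty => simp [coeff_one]
  | cons r s ih =>
    rw [Multiset.map_cons, Multiset.prod_cons, Multiset.card_cons]
    generalize hg : (s.map (X - C ·)).prod = g at ih ⊢
    rcases s.empty_or_exists_mem with rfl | ⟨x, hx⟩
    · obtain rfl : g = 1 := by simpa using hg.symm
      simp [coeff_X, coeff_C]
    have hd : (0 : ℝ) < s.card := by exact_mod_cast Multiset.card_pos_iff_exists_mem.mpr ⟨x, hx⟩
    have h₁ : (X * g).coeff 1 = g.coeff 0 := coeff_X_mul g 0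
    have h₂ : (X * g).coeff 2 = g.coeff 1 := coeff_X_mul g 1
    simp only [sub_mul, coeff_sub, coeff_C_mul, coeff_X_mul_zero, h₁, h₂, Nat.cast_add,
      Nat.cast_one]
    generalize (s.card : ℝ) = d, g.coeff 0 = a, g.coeff 1 = b, g.coeff 2 = c at *
    refine le_of_mul_le_mul_left ?_ hd
    linarith [sq_nonneg (d * a + r * b),
      mul_nonneg (mul_nonneg (by positivity : 0 ≤ d + 1) (sq_nonneg r)) (sub_nonneg.mpr ih)]

open Polynomial in
theorem newton_of_splits {f : ℝ[X]} (hf : f.Splits) {d : ℕ} (hd : f.natDegree ≤ d) :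
    2 * (d : ℝ) * (f.coeff 0 * f.coeff 2) ≤ ((d : ℝ) - 1) * f.coeff 1 ^ 2 := by
  rcases Nat.eq_zero_or_pos f.natDegree with h | h
  · simp [coeff_eq_zero_of_natDegree_lt (show f.natDegree < 1 by omega),
      coeff_eq_zero_of_natDegree_lt (show f.natDegree < 2 by omega)]
  have key := newton_prod_X_sub_C f.roots
  rw [hf.eq_prod_roots]
  simp only [coeff_C_mul]
  rw [← hf.natDegree_eq_card_roots] at key
  have h₁ : (0 : ℝ) < f.natDegree := by exact_mod_cast h
  have h₂ : (f.natDegree : ℝ) ≤ d := by exact_mod_cast hd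
  generalize (f.roots.map (X - C ·)).prod.coeff 0 = x, (f.roots.map (X - C ·)).prod.coeff 1 = y,
    (f.roots.map (X - C ·)).prod.coeff 2 = z, (f.natDegree : ℝ) = m, (d : ℝ) = e,
    f.leadingCoeff = a at *
  have hmain : 2 * e * (x * z) ≤ (e - 1) * y ^ 2 := by
    refine le_of_mul_le_mul_left ?_ h₁
    linarith [mul_le_mul_of_nonneg_left key (h₁.le.trans h₂),
      mul_nonneg (sub_nonneg.mpr h₂) (sq_nonneg y)]
  linarith [mul_le_mul_of_nonneg_left hmain (sq_nonneg a)]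

open Polynomial in
theorem splits_iterate_derivative {f : ℝ[X]} (hf : f.Splits) (j : ℕ) :
    (derivative^[j] f).Splits := by
  induction j with
  | zero => exact hf
  | succ j ih =>
    rw [Function.iterate_succ_apply']
    exact splits_derivative ih

open Polynomial Nat in
/-- Newton's inequalities for the coefficients of a real-rooted polynomial. -/
theorem newton_coeff {f : ℝ[X]} (hf : f.Splits) {d : ℕ} (hd : f.natDegree ≤ d) (j : ℕ)
    (hj : j + 1 < d) :
    f.coeff j * f.coeff (j + 2) * (1 + 1 / ((j : ℝ) + 1)) * (1 + 1 / ((d : ℝ) - (j + 1))) ≤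
      f.coeff (j + 1) ^ 2 := by
  have key := newton_of_splits (splits_iterate_derivative hf j)
    ((natDegree_iterate_derivative f j).trans (Nat.sub_le_sub_right hd j))
  have h₁ : (j + 1).descFactorial j = (j + 1) * j ! := by
    have := Nat.factorial_mul_descFactorial (show j ≤ j + 1 by omega)
    rwa [Nat.add_sub_cancel_left, Nat.factorial_one, one_mul, Nat.factorial_succ] at this
  have h₂ : 2 * (j + 2).descFactorial j = (j + 2) * ((j + 1) * j !) := by
    have := Nat.factorial_mul_descFactorial (show j ≤ j + 2 by omega)
    rwa [Nat.add_sub_cancel_left, Nat.factorial_two, Nat.factorial_succ,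
      Nat.factorial_succ] at this
  have h₂' : (2 : ℝ) * (j + 2).descFactorial j = (j + 2) * ((j + 1) * j !) := by exact_mod_cast h₂
  simp only [coeff_iterate_derivative, zero_add, add_comm 1 j, add_comm 2 j,
    Nat.descFactorial_self, h₁, nsmul_eq_mul, Nat.cast_mul, Nat.cast_add, Nat.cast_one,
    Nat.cast_sub (show j ≤ d by omega)] at key
  have hF : (0 : ℝ) < j ! := by exact_mod_cast Nat.factorial_pos j
  have hD : (0 : ℝ) < d - (j + 1) := by
    rw [sub_pos]
    exact_mod_cast hj
  have hJ : (0 : ℝ) < (j : ℝ) + 1 := by positivity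
  generalize f.coeff j = a, f.coeff (j + 1) = b, f.coeff (j + 2) = c, (j ! : ℝ) = F,
    ((j + 2).descFactorial j : ℝ) = G, (d : ℝ) = e, (j : ℝ) = t at *
  have hmain : (e - t) * (t + 2) * (a * c) ≤ (e - (t + 1)) * (t + 1) * b ^ 2 := by
    refine le_of_mul_le_mul_left ?_ (mul_pos hJ (pow_pos hF 2))
    calc _ = (e - t) * (F * a * ((t + 2) * ((t + 1) * F) * c)) := by ring
      _ = 2 * (e - t) * (F * a * (G * c)) := by rw [← h₂']; ring
      _ ≤ _ := key
      _ = _ := by ring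
  calc _ = (e - t) * (t + 2) * (a * c) / ((e - (t + 1)) * (t + 1)) := by field_simp; ring
    _ ≤ _ := by
      rw [div_le_iff₀ (mul_pos hD hJ)]
      linarith

/-- Strong log-concavity: for every `n ≥ 3` and `2 ≤ k ≤ n − 1`,
`(p_k^{(n)})² ≥ p_{k−1}^{(n)} p_{k+1}^{(n)} (1 + 1/(k−1)) (1 + 1/(n−k))`. -/
theorem p_strong_log_concave (n k : ℕ) (hn : 3 ≤ n) (hk : 2 ≤ k) (hkn : k ≤ n - 1) :
    p n k ^ 2 ≥
      p n (k - 1) * p n (k + 1) * (1 + 1 / ((k : ℝ) - 1)) * (1 + 1 / ((n : ℝ) - (k : ℝ))) := by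
  obtain ⟨j, rfl⟩ := Nat.exists_eq_add_of_le' hk
  obtain ⟨d, rfl⟩ : ∃ d, n = d + 1 := ⟨n - 1, by omega⟩
  have h₀ : (chainPoly (d + 1)).coeff 0 = 0 := by rw [coeff_chainPoly, p_zero_right]; simp
  have hX := Polynomial.divX_mul_X_add (chainPoly (d + 1))
  rw [h₀, Polynomial.C_0, add_zero] at hX
  have hs : (chainPoly (d + 1)).divX.Splits := by
    rw [← Polynomial.splits_mul_X, hX]
    exact splits_chainPoly _
  have hd : (chainPoly (d + 1)).divX.natDegree ≤ d := by
    rw [Polynomial.natDegree_divX_eq_natDegree_tsub_one]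
    have := natDegree_chainPoly_le (d + 1)
    omega
  have h := newton_coeff hs hd j (by omega)
  simp only [Polynomial.coeff_divX, coeff_chainPoly] at h
  rw [show (j + 2 - 1 : ℕ) = j + 1 by omega]
  convert h using 3
  · push_cast
    ring
  · push_cast
    ring
end
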